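/- Let S be a Cu-semigroup satisfying (O6) and (O8), let w ∈ S satisfy 2w = w, let n ≥ 1, and let x₁', …, xₙ', x₁, …, xₙ, z ∈ S satisfy x₁ + … + xₙ ≪ z + w and x₁' ≪ x₁ ≪ x₂' ≪ x₂ ≪ … ≪ xₙ' ≪ xₙ. Then there exist z₁, …, zₙ ∈ S such that z₁ + … + zₙ ≪ z, z₁ ≪ z₂ ≪ … ≪ zₙ, x_j' ≪ z_j + w, and z_j ≪ x_j + w for j = 1, …, n. -/

import Mathlib

variable {S : Type*} [AddCommMonoid S] [PartialOrder S]

/-- The (sequential) way-below relation: `x ≪ y` if for every increasing sequence whose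
supremum dominates `y`, some member of the sequence dominates `x`. -/
def WayBelow (x y : S) : Prop :=
  ∀ f : ℕ → S, Monotone f → ∀ s : S, IsLUB (Set.range f) s → y ≤ s → ∃ n, x ≤ f n

/-- A Cu-semigroup (abstract Cuntz semigroup): a positively ordered commutative monoid
satisfying the axioms (O1)-(O4). -/
structure IsCuSemigroup (S : Type*) [AddCommMonoid S] [PartialOrder S] : Prop where
  zero_le : ∀ x : S, 0 ≤ x
  add_le_add : ∀ {a b c d : S}, a ≤ b → c ≤ d → a + c ≤ b + d
  O1 : ∀ f : ℕ → S, Monotone f → ∃ s : S, IsLUB (Set.range f) s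
  O2 : ∀ x : S, ∃ f : ℕ → S, (∀ n, WayBelow (f n) (f (n + 1))) ∧ IsLUB (Set.range f) x
  O3 : ∀ {x' x y' y : S}, WayBelow x' x → WayBelow y' y → WayBelow (x' + y') (x + y)
  O4 : ∀ f g : ℕ → S, Monotone f → Monotone g → ∀ s t : S, IsLUB (Set.range f) s →
    IsLUB (Set.range g) t → IsLUB (Set.range fun n => f n + g n) (s + t)

/-- Axiom (O5) for Cu-semigroups. -/
def AxiomO5 (S : Type*) [AddCommMonoid S] [PartialOrder S] : Prop :=
  ∀ x' x y' y z : S, x + y ≤ z → WayBelow x' x → WayBelow y' y →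
    ∃ c : S, x' + c ≤ z ∧ z ≤ x + c ∧ WayBelow y' c

/-- Axiom (O6) for Cu-semigroups. -/
def AxiomO6 (S : Type*) [AddCommMonoid S] [PartialOrder S] : Prop :=
  ∀ x' x y z : S, WayBelow x' x → x ≤ y + z →
    ∃ e f : S, x' ≤ e + f ∧ e ≤ x ∧ e ≤ y ∧ f ≤ x ∧ f ≤ z

/-- Axiom (O8) for Cu-semigroups. -/
def AxiomO8 (S : Type*) [AddCommMonoid S] [PartialOrder S] : Prop :=
  ∀ x' x y' y z w : S, 2 • w = w → WayBelow (x + y) (z + w) → WayBelow x' x → WayBelow y' y →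
    ∃ z₁ z₂ : S, WayBelow (z₁ + z₂) z ∧ WayBelow x' (z₁ + w) ∧ WayBelow y' (z₂ + w) ∧
      WayBelow z₁ (x + w) ∧ WayBelow z₂ (y + w)

/-- A Cu-semigroup is weakly cancellative if `x + z ≪ y + z` implies `x ≪ y`. -/
def WeaklyCancellative (S : Type*) [AddCommMonoid S] [PartialOrder S] : Prop :=
  ∀ x y z : S, WayBelow (x + z) (y + z) → WayBelow x y

/-- An element `x` is weakly `(k,ω)`-divisible. -/
def IsWeaklyDivisible (k : ℕ) (x : S) : Prop :=
  ∀ x' : S, WayBelow x' x → ∃ (n : ℕ) (y : Fin n → S),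
    (∀ j, k • y j ≤ x) ∧ x' ≤ ∑ j, y j

/-- An element `x` is `(k,ω)`-divisible. -/
def IsDivisible (k : ℕ) (x : S) : Prop :=
  ∀ x' : S, WayBelow x' x → ∃ (n : ℕ) (y : S), k • y ≤ x ∧ x' ≤ n • y

/-- The interval axiom for Cu-semigroups. -/
def IntervalAxiom (S : Type*) [AddCommMonoid S] [PartialOrder S] : Prop :=
  ∀ x' x y u v : S, WayBelow x' x → WayBelow x (y + u) → WayBelow x (y + v) →
    ∃ w : S, WayBelow x' (y + w) ∧ WayBelow w u ∧ WayBelow w v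

/-- The Riesz Interpolation Property. -/
def RieszInterpolation (S : Type*) [AddCommMonoid S] [PartialOrder S] : Prop :=
  ∀ x₁ x₂ y₁ y₂ : S, x₁ ≤ y₁ → x₁ ≤ y₂ → x₂ ≤ y₁ → x₂ ≤ y₂ →
    ∃ z : S, x₁ ≤ z ∧ x₂ ≤ z ∧ z ≤ y₁ ∧ z ≤ y₂

/-- A Cu-semigroup is countably based if there is a countable subset such that every
element is the supremum of an increasing sequence from that subset. -/
def CountablyBased (S : Type*) [AddCommMonoid S] [PartialOrder S] : Prop :=
  ∃ B : Set S, B.Countable ∧ ∀ x : S, ∃ f : ℕ → S,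
    Monotone f ∧ (∀ n, f n ∈ B) ∧ IsLUB (Set.range f) x

/-- A Cu-semigroup is inf-semilattice ordered if finite infima exist and addition
distributes over them. -/
def InfSemilatticeOrdered (S : Type*) [AddCommMonoid S] [PartialOrder S] : Prop :=
  (∀ x y : S, ∃ m : S, IsGLB {x, y} m) ∧
    ∀ x y z m : S, IsGLB {x, y} m → IsGLB {x + z, y + z} (m + z)

theorem WayBelow.le {T : Type*} [PartialOrder T] {a b : T} (h : WayBelow a b) : a ≤ b := by
  obtain ⟨_, hn⟩ := h (fun _ => b) monotone_const b (by simp) le_rfl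
  exact hn

theorem WayBelow.trans_le {T : Type*} [PartialOrder T] {a b c : T} (h : WayBelow a b)
    (hbc : b ≤ c) : WayBelow a c :=
  fun f hf s hs hc => h f hf s hs (hbc.trans hc)

theorem WayBelow.of_le {T : Type*} [PartialOrder T] {a b c : T} (hab : a ≤ b)
    (h : WayBelow b c) : WayBelow a c := by
  intro f hf s hs hc
  obtain ⟨n, hn⟩ := h f hf s hs hc
  exact ⟨n, hab.trans hn⟩

namespace IsCuSemigroup

theorem exists_wayBelow_between (hS : IsCuSemigroup S) {a b : S} (h : WayBelow a b) :
    ∃ c, WayBelow a c ∧ WayBelow c b := by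
  obtain ⟨f, hf, hb⟩ := hS.O2 b
  obtain ⟨n, hn⟩ := h f (monotone_nat_of_le_succ fun n => (hf n).le) b hb le_rfl
  exact ⟨f (n + 1), .of_le hn (hf n), (hf (n + 1)).trans_le (hb.1 ⟨n + 2, rfl⟩)⟩

theorem zero_wayBelow (hS : IsCuSemigroup S) (a : S) : WayBelow 0 a :=
  fun f _ _ _ _ => ⟨0, hS.zero_le (f 0)⟩

theorem sum_wayBelow_sum (hS : IsCuSemigroup S) {ι : Type*} (s : Finset ι) {a b : ι → S}
    (h : ∀ i, WayBelow (a i) (b i)) : WayBelow (∑ i ∈ s, a i) (∑ i ∈ s, b i) := by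
  classical
  induction s using Finset.induction_on with
  | empty => simpa using hS.zero_wayBelow 0
  | insert i s hi ih => simpa [hi] using hS.O3 (h i) ih

/-- The left summand on the right of `≪` may be replaced by an element way below it. -/
theorem exists_wayBelow_add (hS : IsCuSemigroup S) {a b w : S} (h : WayBelow a (b + w)) :
    ∃ b', WayBelow b' b ∧ WayBelow a (b' + w) := by
  obtain ⟨c, hac, hc⟩ := hS.exists_wayBelow_between h
  obtain ⟨f, hf, hb⟩ := hS.O2 b
  have hmono : Monotone f := monotone_nat_of_le_succ fun n => (hf n).le
  obtain ⟨n, hn⟩ := hc (fun n => f n + w)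
    (fun i j hij => hS.add_le_add (hmono hij) le_rfl) (b + w)
    (hS.O4 f (fun _ => w) hmono monotone_const b w hb (by simp)) le_rfl
  exact ⟨f n, (hf n).trans_le (hb.1 ⟨n + 1, rfl⟩), hac.trans_le hn⟩

/-- Modulo an idempotent `w`, an element `a` with `a ≤ b + w` can be pushed below `b`. -/
theorem exists_le_wayBelow_of_axiomO6 (hS : IsCuSemigroup S) (h6 : AxiomO6 S) {c a b w : S}
    (hw : 2 • w = w) (hc : WayBelow c (a + w)) (hab : a ≤ b + w) :
    ∃ e, e ≤ a ∧ WayBelow e b ∧ WayBelow c (e + w) := by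
  obtain ⟨a', ha', hca'⟩ := hS.exists_wayBelow_add hc
  obtain ⟨e, f, hef, hea, heb, -, hfw⟩ := h6 a' a b w ha' hab
  have hle : a' + w ≤ e + w :=
    calc a' + w ≤ e + f + w := hS.add_le_add hef le_rfl
      _ ≤ e + w + w := hS.add_le_add (hS.add_le_add le_rfl hfw) le_rfl
      _ = e + w := by rw [add_assoc, ← two_nsmul, hw]
  obtain ⟨e', he', hce⟩ := hS.exists_wayBelow_add (hca'.trans_le hle)
  exact ⟨e', he'.le.trans hea, he'.trans_le heb, hce⟩

/-- Axiom (O8) for an increasing family of summands, the empty one included. -/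
theorem exists_ordered_of_axiomO8 (hS : IsCuSemigroup S) (h6 : AxiomO6 S) (h8 : AxiomO8 S)
    {w : S} (hw : 2 • w = w) (n : ℕ) : ∀ (x' x : Fin n → S) (z : S),
    WayBelow (∑ j, x j) (z + w) → (∀ j, WayBelow (x' j) (x j)) →
    (∀ (j : ℕ) (hj : j + 1 < n),
      WayBelow (x ⟨j, Nat.lt_of_succ_lt hj⟩) (x' ⟨j + 1, hj⟩)) →
    ∃ zs : Fin n → S, WayBelow (∑ j, zs j) z ∧
      (∀ (j : ℕ) (hj : j + 1 < n),
        WayBelow (zs ⟨j, Nat.lt_of_succ_lt hj⟩) (zs ⟨j + 1, hj⟩)) ∧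
      (∀ j, WayBelow (x' j) (zs j + w)) ∧ ∀ j, WayBelow (zs j) (x j + w) := by
  induction n with
  | zero =>
    intro x' x z _ _ _
    exact ⟨Fin.elim0, by simpa using hS.zero_wayBelow z, fun j hj => by omega,
      fun j => j.elim0, fun j => j.elim0⟩
  | succ n ih =>
    intro x' x z hsum hx hchain
    choose u hu' hu using fun j : Fin n => hS.exists_wayBelow_between (hx j.succ)
    rw [Fin.sum_univ_succ] at hsum
    obtain ⟨a, b, hab, hxa, hub, hax, -⟩ :=
      h8 _ _ _ _ z w hw hsum (hx 0) (hS.sum_wayBelow_sum Finset.univ hu)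
    obtain ⟨zs, hzsum, hzchain, hxz, hzu⟩ := ih (fun j => x' j.succ) u b hub hu'
      fun j hj => .of_le (hu _).le (hchain (j + 1) (by omega))
    obtain ⟨e, hea, hez, hxe⟩ : ∃ e, e ≤ a ∧
        (∀ h : 0 < n, WayBelow e (zs ⟨0, h⟩)) ∧ WayBelow (x' 0) (e + w) := by
      rcases Nat.eq_zero_or_pos n with hn | hn
      · exact ⟨a, le_rfl, fun h => by omega, hxa⟩
      · have hle : a ≤ zs ⟨0, hn⟩ + w :=
          calc a ≤ x 0 + w := hax.le
            _ ≤ x' (Fin.succ ⟨0, hn⟩) + w :=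
              hS.add_le_add (hchain 0 (by omega)).le le_rfl
            _ ≤ zs ⟨0, hn⟩ + w + w := hS.add_le_add (hxz _).le le_rfl
            _ = zs ⟨0, hn⟩ + w := by rw [add_assoc, ← two_nsmul, hw]
        obtain ⟨e, hea, hez, hxe⟩ := hS.exists_le_wayBelow_of_axiomO6 h6 hw hxa hle
        exact ⟨e, hea, fun _ => hez, hxe⟩
    refine ⟨Fin.cons e zs, ?_, ?_, ?_, ?_⟩
    · rw [Fin.sum_univ_succ]
      exact .of_le (hS.add_le_add hea hzsum.le) hab
    · rintro (_ | j) hj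
      · exact hez (by omega)
      · exact hzchain j (by omega)
    · exact Fin.cases hxe hxz
    · exact Fin.cases (.of_le hea hax)
        fun j => (hzu j).trans_le (hS.add_le_add (hu j).le le_rfl)

end IsCuSemigroup

theorem axiomO8_multiple_ordered (S : Type*) [AddCommMonoid S] [PartialOrder S]
    (hS : IsCuSemigroup S) (h6 : AxiomO6 S) (h8 : AxiomO8 S) (w : S) (hw : 2 • w = w)
    (n : ℕ) (hn : 1 ≤ n) (x' x : Fin n → S) (z : S)
    (hsum : WayBelow (∑ j, x j) (z + w))
    (hx : ∀ j, WayBelow (x' j) (x j))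
    (hchain : ∀ (j : ℕ) (hj : j + 1 < n),
      WayBelow (x ⟨j, Nat.lt_of_succ_lt hj⟩) (x' ⟨j + 1, hj⟩)) :
    ∃ zs : Fin n → S, WayBelow (∑ j, zs j) z ∧
      (∀ (j : ℕ) (hj : j + 1 < n),
        WayBelow (zs ⟨j, Nat.lt_of_succ_lt hj⟩) (zs ⟨j + 1, hj⟩)) ∧
      (∀ j, WayBelow (x' j) (zs j + w)) ∧ ∀ j, WayBelow (zs j) (x j + w) := by
  exact hS.exists_ordered_of_axiomO8 h6 h8 hw n x' x z hsum hx hchain
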